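/- Exact policy-improvement identity for the exponentially tilted (natural policy gradient) update: assume π s a > 0 for all s, a, let F : S → A → ℝ, α ∈ ℝ, β > 0, and let π' be the tilted policy with partition function Z. Then for every initial distribution ρ on S, ∑_{s₀} ρ s₀ · (V^{π'} s₀ − V^π s₀) = (1/β) · ∑_s d_ρ^{π'} s · (∑_a π' s a · log (π' s a / π s a) + log (Z s)) − (1/(1−γ)) · ∑_s d_ρ^{π'} s · ∑_a π' s a · α · F s a. -/

import Mathlib

open scoped BigOperators

variable {S A : Type*}

/-- Induced state-transition matrix of a policy: `(Pmat P pol) s s' = ∑ a, pol s a * P s a s'`. -/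
noncomputable def Pmat [Fintype A] (P : S → A → S → ℝ) (pol : S → A → ℝ) :
    Matrix S S ℝ :=
  Matrix.of fun s s' => ∑ a, pol s a * P s a s'

/-- Induced reward vector of a policy: `(rvec r pol) s = ∑ a, pol s a * r s a`. -/
noncomputable def rvec [Fintype A] (r : S → A → ℝ) (pol : S → A → ℝ) : S → ℝ :=
  fun s => ∑ a, pol s a * r s a

/-- Value function: `V^π s = ∑' t, γ^t * ((P_π)^t r_π) s`. -/
noncomputable def Vval [Fintype S] [DecidableEq S] [Fintype A]
    (P : S → A → S → ℝ) (r : S → A → ℝ) (γ : ℝ) (pol : S → A → ℝ) : S → ℝ :=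
  fun s => ∑' t : ℕ, γ ^ t * ((Pmat P pol ^ t).mulVec (rvec r pol)) s

/-- Action-value function: `Q^π s a = r s a + γ * ∑ s', P s a s' * V^π s'`. -/
noncomputable def Qval [Fintype S] [DecidableEq S] [Fintype A]
    (P : S → A → S → ℝ) (r : S → A → ℝ) (γ : ℝ) (pol : S → A → ℝ) : S → A → ℝ :=
  fun s a => r s a + γ * ∑ s', P s a s' * Vval P r γ pol s'

/-- Advantage function: `A^π s a = Q^π s a - V^π s`. -/
noncomputable def Adv [Fintype S] [DecidableEq S] [Fintype A]
    (P : S → A → S → ℝ) (r : S → A → ℝ) (γ : ℝ) (pol : S → A → ℝ) : S → A → ℝ :=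
  fun s a => Qval P r γ pol s a - Vval P r γ pol s

/-- Discounted state-visitation distribution from start state `s₀`. -/
noncomputable def dvisit [Fintype S] [DecidableEq S] [Fintype A]
    (P : S → A → S → ℝ) (γ : ℝ) (pol : S → A → ℝ) (s₀ : S) : S → ℝ :=
  fun s => (1 - γ) * ∑' t : ℕ, γ ^ t * (Pmat P pol ^ t) s₀ s

/-- Discounted state-visitation distribution under an initial distribution `ρ`. -/
noncomputable def dvisitInit [Fintype S] [DecidableEq S] [Fintype A]
    (P : S → A → S → ℝ) (γ : ℝ) (pol : S → A → ℝ) (ρ : S → ℝ) : S → ℝ :=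
  fun s => ∑ s₀, ρ s₀ * dvisit P γ pol s₀ s

/-- Potential-based shaped reward:
`r' s a = r s a + α * (γ * ∑ s', P s a s' * Φ s' - Φ s)`. -/
noncomputable def shaped [Fintype S] (P : S → A → S → ℝ) (r : S → A → ℝ) (γ : ℝ)
    (Φ : S → ℝ) (α : ℝ) : S → A → ℝ :=
  fun s a => r s a + α * (γ * ∑ s', P s a s' * Φ s' - Φ s)

/-- Softmax distribution on a finite type. -/
noncomputable def softmax [Fintype A] (θ : A → ℝ) (a : A) : ℝ :=
  Real.exp (θ a) / ∑ b, Real.exp (θ b)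

/-- Partition function of the exponentially tilted (NPG) update. -/
noncomputable def Zfun [Fintype S] [DecidableEq S] [Fintype A]
    (P : S → A → S → ℝ) (r : S → A → ℝ) (γ : ℝ) (pol : S → A → ℝ)
    (F : S → A → ℝ) (α β : ℝ) (s : S) : ℝ :=
  ∑ a, pol s a * Real.exp (β * (Adv P r γ pol s a + α * F s a) / (1 - γ))

/-- Exponentially tilted (NPG) policy update. -/
noncomputable def tilted [Fintype S] [DecidableEq S] [Fintype A]
    (P : S → A → S → ℝ) (r : S → A → ℝ) (γ : ℝ) (pol : S → A → ℝ)
    (F : S → A → ℝ) (α β : ℝ) (s : S) (a : A) : ℝ :=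
  pol s a * Real.exp (β * (Adv P r γ pol s a + α * F s a) / (1 - γ)) /
    Zfun P r γ pol F α β s


/-- The state-transition matrix induced by a policy is row stochastic. -/
lemma Pmat_mem_rowStochastic [Fintype S] [DecidableEq S] [Fintype A]
    {P : S → A → S → ℝ} (hP0 : ∀ s a s', 0 ≤ P s a s') (hP1 : ∀ s a, ∑ s', P s a s' = 1)
    {pol : S → A → ℝ} (h0 : ∀ s a, 0 ≤ pol s a) (h1 : ∀ s, ∑ a, pol s a = 1) :
    Pmat P pol ∈ Matrix.rowStochastic ℝ S := by
  rw [Matrix.mem_rowStochastic_iff_sum]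
  refine ⟨fun i j => Finset.sum_nonneg fun a _ => mul_nonneg (h0 i a) (hP0 i a j), fun i => ?_⟩
  simp only [Pmat, Matrix.of_apply]
  rw [Finset.sum_comm]
  simp [← Finset.mul_sum, hP1, h1]

lemma summable_discounted_pow_apply [Fintype S] [DecidableEq S] {M : Matrix S S ℝ}
    (hM : M ∈ Matrix.rowStochastic ℝ S) {γ : ℝ} (hγ0 : 0 ≤ γ) (hγ1 : γ < 1) (s₀ s : S) :
    Summable fun t : ℕ => γ ^ t * (M ^ t) s₀ s := by
  have hMt (t : ℕ) : M ^ t ∈ Matrix.rowStochastic ℝ S := pow_mem hM t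
  refine Summable.of_nonneg_of_le (fun t => ?_) (fun t => ?_)
    (summable_geometric_of_lt_one hγ0 hγ1)
  · exact mul_nonneg (pow_nonneg hγ0 t) (Matrix.nonneg_of_mem_rowStochastic (hMt t))
  · exact mul_le_of_le_one_right (pow_nonneg hγ0 t) (Matrix.le_one_of_mem_rowStochastic (hMt t))

/-- Discounted sums of `M ^ t *ᵥ v` are obtained by applying the discounted sum of the powers
of `M` to `v`. -/
lemma hasSum_discounted_pow_mulVec [Fintype S] [DecidableEq S] {M : Matrix S S ℝ}
    (hM : M ∈ Matrix.rowStochastic ℝ S) {γ : ℝ} (hγ0 : 0 ≤ γ) (hγ1 : γ < 1)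
    (v : S → ℝ) (s₀ : S) :
    HasSum (fun t : ℕ => γ ^ t * ((M ^ t).mulVec v) s₀)
      (∑ s, (∑' t : ℕ, γ ^ t * (M ^ t) s₀ s) * v s) := by
  have h := hasSum_sum fun s (_ : s ∈ Finset.univ) =>
    (summable_discounted_pow_apply hM hγ0 hγ1 s₀ s).hasSum.mul_right (v s)
  simpa only [Matrix.mulVec, dotProduct, Finset.mul_sum, mul_assoc] using h

/-- The discounted sum of the powers of `M` is a left inverse of `1 - γ M`. -/
lemma sum_discounted_pow_mul_sub [Fintype S] [DecidableEq S] {M : Matrix S S ℝ}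
    (hM : M ∈ Matrix.rowStochastic ℝ S) {γ : ℝ} (hγ0 : 0 ≤ γ) (hγ1 : γ < 1)
    (v : S → ℝ) (s₀ : S) :
    ∑ s, (∑' t : ℕ, γ ^ t * (M ^ t) s₀ s) * (v s - γ * (M.mulVec v) s) = v s₀ := by
  have hv := hasSum_discounted_pow_mulVec hM hγ0 hγ1 v s₀
  have hMv := (hasSum_discounted_pow_mulVec hM hγ0 hγ1 (M.mulVec v) s₀).mul_left γ
  have hshift (t : ℕ) : γ * (γ ^ t * ((M ^ t).mulVec (M.mulVec v)) s₀) =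
      γ ^ (t + 1) * ((M ^ (t + 1)).mulVec v) s₀ := by
    rw [Matrix.mulVec_mulVec, ← pow_succ, pow_succ γ]
    ring
  simp only [hshift] at hMv
  have h := hv.summable.tsum_eq_zero_add
  rw [hv.tsum_eq, hMv.tsum_eq] at h
  simp only [pow_zero, Matrix.one_mulVec, one_mul] at h
  simp only [mul_sub, Finset.sum_sub_distrib, mul_left_comm _ γ, ← Finset.mul_sum]
  linarith

/-- The performance difference lemma. -/
lemma Vval_sub_Vval [Fintype S] [DecidableEq S] [Fintype A]
    {P : S → A → S → ℝ} (hP0 : ∀ s a s', 0 ≤ P s a s') (hP1 : ∀ s a, ∑ s', P s a s' = 1)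
    (r : S → A → ℝ) {γ : ℝ} (hγ0 : 0 ≤ γ) (hγ1 : γ < 1) (π : S → A → ℝ)
    {pol : S → A → ℝ} (h0 : ∀ s a, 0 ≤ pol s a) (h1 : ∀ s, ∑ a, pol s a = 1) (s₀ : S) :
    Vval P r γ pol s₀ - Vval P r γ π s₀ =
      (1 / (1 - γ)) * ∑ s, dvisit P γ pol s₀ s * ∑ a, pol s a * Adv P r γ π s a := by
  have hM := Pmat_mem_rowStochastic hP0 hP1 h0 h1
  have hγ : 1 - γ ≠ 0 := by linarith
  have hadv (s : S) : ∑ a, pol s a * Adv P r γ π s a =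
      rvec r pol s -
        (Vval P r γ π s - γ * ((Pmat P pol).mulVec (Vval P r γ π)) s) := by
    have hnext : ((Pmat P pol).mulVec (Vval P r γ π)) s =
        ∑ a, pol s a * ∑ s', P s a s' * Vval P r γ π s' := by
      simp only [Matrix.mulVec, dotProduct, Pmat, Matrix.of_apply, Finset.sum_mul,
        Finset.mul_sum, mul_assoc]
      exact Finset.sum_comm
    simp only [Adv, Qval, hnext, rvec, mul_sub, mul_add, Finset.sum_sub_distrib,
      Finset.sum_add_distrib, ← Finset.sum_mul, h1, mul_left_comm _ γ, ← Finset.mul_sum]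
    ring
  have hV : Vval P r γ pol s₀ =
      ∑ s, (∑' t : ℕ, γ ^ t * (Pmat P pol ^ t) s₀ s) * rvec r pol s :=
    (hasSum_discounted_pow_mulVec hM hγ0 hγ1 _ s₀).tsum_eq
  rw [hV, ← sum_discounted_pow_mul_sub hM hγ0 hγ1 (Vval P r γ π) s₀,
    ← Finset.sum_sub_distrib, Finset.mul_sum]
  refine Finset.sum_congr rfl fun s _ => ?_
  rw [hadv, dvisit]
  field_simp

theorem exact_policy_improvement_identity [Fintype S] [DecidableEq S] [Nonempty S] [Fintype A] [Nonempty A]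
    (P : S → A → S → ℝ) (hP0 : ∀ s a s', 0 ≤ P s a s') (hP1 : ∀ s a, ∑ s', P s a s' = 1)
    (r : S → A → ℝ) (γ : ℝ) (hγ0 : 0 ≤ γ) (hγ1 : γ < 1)
    (π : S → A → ℝ) (hπpos : ∀ s a, 0 < π s a) (hπ1 : ∀ s, ∑ a, π s a = 1)
    (ρ : S → ℝ) (hρ0 : ∀ s, 0 ≤ ρ s) (hρ1 : ∑ s, ρ s = 1)
    (F : S → A → ℝ) (α β : ℝ) (hβ : 0 < β) :
    (∑ s₀, ρ s₀ * (Vval P r γ (tilted P r γ π F α β) s₀ - Vval P r γ π s₀)) =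
      (1 / β) * (∑ s, dvisitInit P γ (tilted P r γ π F α β) ρ s *
          ((∑ a, tilted P r γ π F α β s a *
              Real.log (tilted P r γ π F α β s a / π s a)) +
            Real.log (Zfun P r γ π F α β s))) -
        (1 / (1 - γ)) * (∑ s, dvisitInit P γ (tilted P r γ π F α β) ρ s *
          ∑ a, tilted P r γ π F α β s a * (α * F s a)) := by
  have hZ (s : S) : 0 < Zfun P r γ π F α β s :=
    Finset.sum_pos (fun a _ => mul_pos (hπpos s a) (Real.exp_pos _)) Finset.univ_nonempty
  have hpos (s : S) (a : A) : 0 ≤ tilted P r γ π F α β s a :=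
    (div_pos (mul_pos (hπpos s a) (Real.exp_pos _)) (hZ s)).le
  have hsum (s : S) : ∑ a, tilted P r γ π F α β s a = 1 := by
    simp only [tilted, ← Finset.sum_div]
    exact div_self (hZ s).ne'
  have hγ : 1 - γ ≠ 0 := by linarith
  have hlog (s : S) (a : A) : Real.log (tilted P r γ π F α β s a / π s a) =
      β * (Adv P r γ π s a + α * F s a) / (1 - γ) - Real.log (Zfun P r γ π F α β s) := by
    have hquot : tilted P r γ π F α β s a / π s a =
        Real.exp (β * (Adv P r γ π s a + α * F s a) / (1 - γ)) / Zfun P r γ π F α β s := by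
      have := (hπpos s a).ne'
      rw [tilted]
      field_simp
    rw [hquot, Real.log_div (Real.exp_pos _).ne' (hZ s).ne', Real.log_exp]
  have hterm (s : S) :
      (∑ a, tilted P r γ π F α β s a * Real.log (tilted P r γ π F α β s a / π s a)) +
        Real.log (Zfun P r γ π F α β s) =
      β / (1 - γ) * ((∑ a, tilted P r γ π F α β s a * Adv P r γ π s a) +
        ∑ a, tilted P r γ π F α β s a * (α * F s a)) := by
    simp only [hlog, mul_sub, Finset.sum_sub_distrib, ← Finset.sum_mul, hsum]
    rw [one_mul, sub_add_cancel, ← Finset.sum_add_distrib, Finset.mul_sum]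
    exact Finset.sum_congr rfl fun a _ => by ring
  have hdiff : ∑ s₀, ρ s₀ * (Vval P r γ (tilted P r γ π F α β) s₀ - Vval P r γ π s₀) =
      (1 / (1 - γ)) * ∑ s, dvisitInit P γ (tilted P r γ π F α β) ρ s *
        ∑ a, tilted P r γ π F α β s a * Adv P r γ π s a := by
    simp only [Vval_sub_Vval hP0 hP1 r hγ0 hγ1 π hpos hsum, dvisitInit]
    simp only [mul_left_comm _ (1 / (1 - γ)), ← Finset.mul_sum]
    congr 1
    simp only [Finset.mul_sum (s := Finset.univ (α := S)), Finset.sum_mul, ← mul_assoc]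
    exact Finset.sum_comm
  rw [hdiff]
  simp only [hterm, Finset.mul_sum (s := Finset.univ (α := S))]
  rw [← Finset.sum_sub_distrib]
  refine Finset.sum_congr rfl fun s _ => ?_
  generalize ∑ a, tilted P r γ π F α β s a * (α * F s a) = x
  field_simp
  ring
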